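/- arXiv:0912.4743 — 2 statements merged into one kernel-verified Lean document; each statement's English description precedes it below -/
import Mathlib

section
/- Let t > 0 and let h : (0,∞) → ℝ be a bounded measurable function that is differentiable on (0,∞) with bounded derivative. Then there exists a constant C > 0 such that for all integers n ≥ 1, | (nⁿ / (tⁿ (n−1)!)) ∫₀^∞ h(s) s^{n−1} e^{−ns/t} ds − h(t) | ≤ C n^{−1/2}. In other words, if G_n is a Gamma(n, n/t) random variable (the sum of n i.i.d. exponentials of mean t/n), then E[h(G_n)] = h(t) + O(n^{−1/2}) as n → ∞. -/
open MeasureTheory Real Set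

noncomputable section

theorem integrableOn_pow_mul_exp_neg_mul (k : ℕ) {b : ℝ} (hb : 0 < b) :
    IntegrableOn (fun s : ℝ => s ^ k * Real.exp (-(b * s))) (Ioi 0) := by
  have := integrableOn_rpow_mul_exp_neg_mul_rpow (p := 1) (s := k) (b := b)
    (by linarith [(Nat.cast_nonneg k : (0 : ℝ) ≤ k)]) one_pos hb
  simpa [Real.rpow_natCast] using this

theorem integral_pow_mul_exp_neg_mul (k : ℕ) {b : ℝ} (hb : 0 < b) :
    ∫ s in Ioi (0 : ℝ), s ^ k * Real.exp (-(b * s)) = (Nat.factorial k : ℝ) / b ^ (k + 1) := by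
  have key := Real.integral_rpow_mul_exp_neg_mul_Ioi (a := (k : ℝ) + 1) (r := b) (by positivity) hb
  rw [Real.Gamma_nat_eq_factorial, add_sub_cancel_right] at key
  simp only [Real.rpow_natCast] at key
  rw [key, ← Nat.cast_succ, Real.rpow_natCast, one_div, inv_pow, Nat.succ_eq_add_one]
  field_simp

/-- Integral of `u (s - t)² + v` against the unnormalized `Gamma (m + 1, b)` density. -/
theorem integrableOn_and_integral_quadratic_mul_gamma (m : ℕ) {b : ℝ} (hb : 0 < b) (t u v : ℝ) :
    IntegrableOn (fun s : ℝ => (u * (s - t) ^ 2 + v) * (s ^ m * Real.exp (-(b * s)))) (Ioi 0) ∧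
    ∫ s in Ioi (0 : ℝ), (u * (s - t) ^ 2 + v) * (s ^ m * Real.exp (-(b * s))) =
      (Nat.factorial m : ℝ) / b ^ (m + 1) *
        (u * ((m + 1) * (m + 2) / b ^ 2 - 2 * t * (m + 1) / b + t ^ 2) + v) := by
  have i0 := (integrableOn_pow_mul_exp_neg_mul m hb).const_mul (u * t ^ 2 + v)
  have i1 := (integrableOn_pow_mul_exp_neg_mul (m + 1) hb).const_mul (-(2 * u * t))
  have i2 := (integrableOn_pow_mul_exp_neg_mul (m + 2) hb).const_mul u
  have expand : (fun s : ℝ => (u * (s - t) ^ 2 + v) * (s ^ m * Real.exp (-(b * s)))) =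
      fun s => u * (s ^ (m + 2) * Real.exp (-(b * s))) +
        -(2 * u * t) * (s ^ (m + 1) * Real.exp (-(b * s))) +
        (u * t ^ 2 + v) * (s ^ m * Real.exp (-(b * s))) := by
    funext s; ring
  rw [expand]
  refine ⟨(i2.add i1).add i0, ?_⟩
  rw [integral_add (by exact i2.add i1) i0, integral_add i2 i1]
  simp only [integral_const_mul, integral_pow_mul_exp_neg_mul _ hb, Nat.factorial_succ]
  push_cast
  field_simp
  ring

/-- A function on `(0, ∞)` with derivative bounded by `M` is `M`-Lipschitz there. -/
theorem abs_sub_le_of_abs_hasDerivAt_le {h h' : ℝ → ℝ} {M : ℝ}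
    (h_diff : ∀ s : ℝ, 0 < s → HasDerivAt h (h' s) s)
    (hM : ∀ s : ℝ, 0 < s → |h' s| ≤ M) {s t : ℝ} (hs : 0 < s) (ht : 0 < t) :
    |h s - h t| ≤ M * |s - t| :=
  (convex_Ioi (0 : ℝ)).norm_image_sub_le_of_norm_hasDerivWithin_le
    (fun x hx => (h_diff x hx).hasDerivWithinAt) (fun x hx => hM x hx) ht hs

/-- The weighted AM-GM bound on the absolute value by the square. -/
theorem abs_le_sq_add_inv {r : ℝ} (hr : 0 < r) (x : ℝ) :
    |x| ≤ r / 2 * x ^ 2 + 1 / (2 * r) := by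
  have key : r / 2 * x ^ 2 + 1 / (2 * r) - |x| = (r * |x| - 1) ^ 2 / (2 * r) := by
    rw [← sq_abs x]; field_simp; ring
  linarith [show 0 ≤ (r * |x| - 1) ^ 2 / (2 * r) by positivity]

/-- **Rate of convergence of the Gamma-time approximation (Lemma 2, analytic form).**
Let `t > 0` and let `h : (0,∞) → ℝ` be a bounded measurable function that is
differentiable on `(0,∞)` with bounded derivative.  Then there is a constant
`C > 0` such that for all `n ≥ 1`,
`| nⁿ/(tⁿ (n−1)!) ∫₀^∞ h(s) s^{n−1} e^{−ns/t} ds − h(t) | ≤ C n^{−1/2}`;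
i.e. if `G_n ∼ Gamma(n, n/t)` then `E[h(G_n)] = h(t) + O(n^{−1/2})`. -/
theorem gamma_time_rate_of_convergence
    (t : ℝ) (ht : 0 < t)
    (h h' : ℝ → ℝ)
    (h_meas : Measurable h)
    (h_bdd : ∃ M : ℝ, ∀ s : ℝ, 0 < s → |h s| ≤ M)
    (h_diff : ∀ s : ℝ, 0 < s → HasDerivAt h (h' s) s)
    (h'_bdd : ∃ M' : ℝ, ∀ s : ℝ, 0 < s → |h' s| ≤ M') :
    ∃ C : ℝ, 0 < C ∧ ∀ n : ℕ, 1 ≤ n →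
      |(n : ℝ) ^ n / (t ^ n * (Nat.factorial (n - 1) : ℝ)) *
          (∫ s in Ioi (0 : ℝ), h s * s ^ (n - 1) * Real.exp (-((n : ℝ) * s) / t))
        - h t| ≤ C * (n : ℝ) ^ (-(1 : ℝ) / 2) := by
  obtain ⟨M, hM⟩ := h_bdd
  obtain ⟨L, hL⟩ := h'_bdd
  have hL0 : 0 ≤ L := (abs_nonneg _).trans (hL 1 one_pos)
  refine ⟨L * t + 1, by positivity, fun n hn => ?_⟩
  obtain ⟨m, rfl⟩ : ∃ m, n = m + 1 := ⟨n - 1, by omega⟩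
  simp only [Nat.add_sub_cancel]
  have hn0 : (0 : ℝ) < ((m + 1 : ℕ) : ℝ) := by positivity
  set b : ℝ := ((m + 1 : ℕ) : ℝ) / t with hb_def
  have hb : 0 < b := by positivity
  set w : ℝ → ℝ := fun s => s ^ m * Real.exp (-(b * s)) with hw
  have w_int : IntegrableOn w (Ioi 0) := integrableOn_pow_mul_exp_neg_mul m hb
  have hw_int : IntegrableOn (fun s => h s * w s) (Ioi 0) := by
    refine Integrable.bdd_mul w_int h_meas.aestronglyMeasurable (c := M) ?_
    exact (ae_restrict_iff' measurableSet_Ioi).mpr (ae_of_all _ fun s hs => hM s hs)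
  set c : ℝ := b ^ (m + 1) / (Nat.factorial m : ℝ) with hc_def
  have hfac : (0 : ℝ) < Nat.factorial m := by positivity
  have hc : 0 < c := by positivity
  have c_eq : ((m + 1 : ℕ) : ℝ) ^ (m + 1) / (t ^ (m + 1) * (Nat.factorial m : ℝ)) = c := by
    rw [hc_def, hb_def, div_pow, div_div]
  have mass : c * ∫ s in Ioi (0 : ℝ), w s = 1 := by
    rw [hw, integral_pow_mul_exp_neg_mul m hb, hc_def]
    field_simp
  have integrand_eq : (fun s : ℝ => h s * s ^ m * Real.exp (-(((m + 1 : ℕ) : ℝ) * s) / t)) =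
      fun s => h s * w s := by
    funext s
    rw [hw, hb_def, mul_assoc, neg_div, mul_div_right_comm]
  have centered : c * (∫ s in Ioi (0 : ℝ), h s * w s) - h t =
      c * ∫ s in Ioi (0 : ℝ), (h s * w s - h t * w s) := by
    rw [integral_sub hw_int (w_int.const_mul _), integral_const_mul]
    linear_combination h t * mass
  rw [c_eq, integrand_eq, centered, abs_mul, abs_of_pos hc]
  set q : ℝ := √((m + 1 : ℕ) : ℝ) with hq_def
  have hq : 0 < q := Real.sqrt_pos.mpr hn0
  have q_sq : q ^ 2 = (m : ℝ) + 1 := by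
    rw [hq_def, Real.sq_sqrt hn0.le]; push_cast; ring
  have hr : 0 < q / t := by positivity
  obtain ⟨g_int, g_eq⟩ := integrableOn_and_integral_quadratic_mul_gamma m hb t
    (L * (q / t / 2)) (L * (1 / (2 * (q / t))))
  have bound : |∫ s in Ioi (0 : ℝ), (h s * w s - h t * w s)| ≤
      ∫ s in Ioi (0 : ℝ), (L * (q / t / 2) * (s - t) ^ 2 + L * (1 / (2 * (q / t)))) *
        (s ^ m * Real.exp (-(b * s))) := by
    rw [← Real.norm_eq_abs]
    refine norm_integral_le_of_norm_le g_int ?_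
    refine (ae_restrict_iff' measurableSet_Ioi).mpr (ae_of_all _ fun s (hs : 0 < s) => ?_)
    have w_nonneg : 0 ≤ w s := by simp only [hw]; positivity
    rw [← sub_mul, norm_mul, Real.norm_of_nonneg w_nonneg]
    refine mul_le_mul_of_nonneg_right ?_ w_nonneg
    calc ‖h s - h t‖ ≤ L * |s - t| := abs_sub_le_of_abs_hasDerivAt_le h_diff hL hs ht
      _ ≤ L * (q / t / 2 * (s - t) ^ 2 + 1 / (2 * (q / t))) :=
        mul_le_mul_of_nonneg_left (abs_le_sq_add_inv hr _) hL0
      _ = _ := by ring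
  have rate : (((m + 1 : ℕ) : ℝ)) ^ (-(1 : ℝ) / 2) = 1 / q := by
    rw [neg_div, Real.rpow_neg hn0.le, ← Real.sqrt_eq_rpow, one_div]
  rw [g_eq] at bound
  have hb' : b = q ^ 2 / t := by rw [hb_def, q_sq]; push_cast; ring
  have m_eq : (m : ℝ) = q ^ 2 - 1 := by linarith
  calc c * |∫ s in Ioi (0 : ℝ), (h s * w s - h t * w s)|
      ≤ c * _ := mul_le_mul_of_nonneg_left bound hc.le
    _ = L * t * (1 / q) := by
      rw [← mul_assoc, show c * ((Nat.factorial m : ℝ) / b ^ (m + 1)) = 1 by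
        rw [hc_def]; field_simp, m_eq, hb']
      field_simp
      ring
    _ ≤ (L * t + 1) * (1 / q) := by gcongr; linarith
    _ = _ := by rw [rate]

end
end

section
/- Let a ∈ ℝ, σ ∈ ℝ, c₁, c₂, α₁, α₂, β₁, β₂ > 0 and λ₁, λ₂ ∈ (0,3)\{1,2}, and let Ψ be the β-class characteristic exponent with these parameters, extended to a meromorphic function of z ∈ ℂ by the same formula. Then for every q > 0 there exist real sequences (ζₙ⁺)_{n≥0} and (ζₙ⁻)_{n≥0} with ζ₀⁺ ∈ (0, β₂α₂), ζ₀⁻ ∈ (−β₁α₁, 0), ζₙ⁺ ∈ (β₂(α₂+n−1), β₂(α₂+n)) for n ≥ 1 and ζₙ⁻ ∈ (−β₁(α₁+n), −β₁(α₁+n−1)) for n ≥ 1, such that the set of solutions z ∈ ℂ of q + Ψ(z) = 0 is exactly { iζₙ⁺ : n ≥ 0 } ∪ { iζₙ⁻ : n ≥ 0 }, and every such solution is a simple zero of z ↦ q + Ψ(z). -/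
open Set

noncomputable section

/-- The Beta function `B(x,y) = Γ(x)Γ(y)/Γ(x+y)` built from the complex Gamma function. -/
def cBeta (x y : ℂ) : ℂ := Complex.Gamma x * Complex.Gamma y / Complex.Gamma (x + y)

/-- The characteristic exponent of the β-class of Lévy processes with parameters
`(a, σ, c₁, c₂, α₁, α₂, β₁, β₂, lam₁, lam₂)`, extended to a meromorphic function of a
complex variable `z` by the same formula. -/
def betaClassExponent (a σ c₁ c₂ α₁ α₂ β₁ β₂ lam₁ lam₂ : ℝ) (z : ℂ) : ℂ :=
  Complex.I * a * z + (σ : ℂ) ^ 2 * z ^ 2 / 2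
    + (c₁ / β₁ : ℂ) * (cBeta α₁ (1 - lam₁)
        - cBeta ((α₁ : ℂ) - Complex.I * z / β₁) (1 - lam₁))
    + (c₂ / β₂ : ℂ) * (cBeta α₂ (1 - lam₂)
        - cBeta ((α₂ : ℂ) + Complex.I * z / β₂) (1 - lam₂))

/-- The set of poles of the β-class characteristic exponent, as a meromorphic
function on `ℂ`: the points `−iβ₁(α₁+n)` and `iβ₂(α₂+n)`, `n ≥ 0`. -/
def betaClassPoles (α₁ α₂ β₁ β₂ : ℝ) : Set ℂ :=
  {z : ℂ | ∃ n : ℕ, z = -Complex.I * (β₁ * (α₁ + n))}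
    ∪ {z : ℂ | ∃ n : ℕ, z = Complex.I * (β₂ * (α₂ + n))}

section RootsAux

open Filter Topology Finset

/-- Rational approximant of `n ^ (y + 1) * Γ(x) / Γ(x + y)`. -/
def gammaRatioApprox (y : ℝ) (n : ℕ) (x : ℂ) : ℂ :=
  (∏ j ∈ range (n + 1), (x + y + j) / (x + j)) * (x + y + n + 1)

theorem gammaRatioApprox_succ (y : ℝ) (n : ℕ) (x : ℂ) (hx : x + n + 1 ≠ 0) :
    gammaRatioApprox y (n + 1) x =
      gammaRatioApprox y n x + (y + 1) * gammaRatioApprox y n x / (x + n + 1) := by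
  unfold gammaRatioApprox
  rw [prod_range_succ _ (n + 1)]
  have hx' : x + (n + 1) ≠ 0 := by rwa [← add_assoc]
  push_cast
  field_simp
  ring

theorem exists_gammaRatioApprox_eq_sum {y : ℝ} (hy : -2 < y) (hy' : y < 1) (n : ℕ) :
    ∃ (c : ℂ) (r : ℕ → ℝ), (∀ k ≤ n, 0 ≤ y * (y + 1) * r k) ∧
      ∀ x : ℂ, (∀ k ≤ n, x + (k : ℕ) ≠ 0) →
        gammaRatioApprox y n x = x + c + ∑ k ∈ range (n + 1), (r k : ℂ) / (x + k) := by
  induction n with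
  | zero =>
    refine ⟨2 * y + 1, fun _ => y * (y + 1), fun k _ => mul_self_nonneg _, fun x hx => ?_⟩
    have h0 : x ≠ 0 := by simpa using hx 0 le_rfl
    simp only [gammaRatioApprox, zero_add, prod_range_one, sum_range_one]
    push_cast
    simp only [add_zero]
    field_simp
    ring
  | succ n ih =>
    obtain ⟨c, r, hr, h⟩ := ih
    have hR : ∃ p : ℝ, 0 ≤ p ∧ gammaRatioApprox y n (-(n + 1)) = (p : ℂ) * y := by
      refine ⟨∏ j ∈ range (n + 1), (((n : ℝ) + 1 - j - y) / (n + 1 - j)),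
        prod_nonneg fun j hj => ?_, ?_⟩
      · have : (j : ℝ) ≤ n := by exact_mod_cast Nat.lt_succ_iff.mp (mem_range.mp hj)
        exact div_nonneg (by linarith) (by linarith)
      · unfold gammaRatioApprox
        push_cast
        congr 1
        · refine prod_congr rfl fun j _ => ?_
          rw [← neg_div_neg_eq]
          congr 1 <;> ring
        · ring
    obtain ⟨p, hp, hpR⟩ := hR
    have hneg := h (-(n + 1)) fun k hk => by
      have : ((n : ℝ) + 1 - k) ≠ 0 := by
        have : (k : ℝ) ≤ n := by exact_mod_cast hk
        linarith
      intro h0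
      apply this
      have h1 : ((n : ℂ) + 1 - k) = 0 := by linear_combination -h0
      exact_mod_cast h1
    refine ⟨c + (y + 1), fun k => if k = n + 1 then y * (y + 1) * p else
      r k * (1 + (y + 1) / (n + 1 - k)), fun k hk => ?_, fun x hx => ?_⟩
    · beta_reduce
      split_ifs with hkn
      · rw [← mul_assoc]
        exact mul_nonneg (mul_self_nonneg _) hp
      · have hk' : k ≤ n := by lia
        have : (k : ℝ) ≤ n := by exact_mod_cast hk'
        rw [← mul_assoc]
        refine mul_nonneg (hr k hk') ?_
        have h1 : (0 : ℝ) < n + 1 - k := by linarith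
        rw [show 1 + (y + 1) / ((n : ℝ) + 1 - k) = (n + 1 - k + (y + 1)) / (n + 1 - k) by
          field_simp]
        exact div_nonneg (by linarith) h1.le
    · have hx1 : x + n + 1 ≠ 0 := by simpa [add_assoc] using hx (n + 1) le_rfl
      rw [gammaRatioApprox_succ _ _ _ hx1, sum_range_succ _ (n + 1)]
      have hxn := h x fun k hk => hx k (by lia)
      have key : gammaRatioApprox y n x / (x + n + 1) = 1 + (p : ℂ) * y / (x + n + 1) +
          ∑ k ∈ range (n + 1), (r k : ℂ) / (n + 1 - k) / (x + k) := by
        rw [div_eq_iff hx1, add_mul, add_mul, div_mul_cancel₀ _ hx1, ← hpR, hneg, hxn, sum_mul]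
        have : ∑ k ∈ range (n + 1), (r k : ℂ) / (x + k) =
            ∑ k ∈ range (n + 1), (r k : ℂ) / (-(n + 1) + k) +
            ∑ k ∈ range (n + 1), (r k : ℂ) / (n + 1 - k) / (x + k) * (x + n + 1) := by
          rw [← sum_add_distrib]
          refine sum_congr rfl fun k hk => ?_
          have hk' : k ≤ n := Nat.lt_succ_iff.mp (mem_range.mp hk)
          have hk1 : x + k ≠ 0 := hx k (by lia)
          have hk2 : (n : ℂ) + 1 - k ≠ 0 := by
            have : (k : ℝ) ≤ n := by exact_mod_cast hk'
            have : (n : ℝ) + 1 - k ≠ 0 := by linarith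
            exact_mod_cast this
          rw [show (-(n + 1) + k : ℂ) = -(n + 1 - k) by ring]
          field_simp
          ring
        rw [this]
        ring
      rw [mul_div_assoc, key, hxn]
      have h2 : ∑ k ∈ range (n + 1), (((if k = n + 1 then y * (y + 1) * p else
          r k * (1 + (y + 1) / (n + 1 - k)) : ℝ)) : ℂ) / (x + k) =
          ∑ k ∈ range (n + 1), (r k : ℂ) / (x + k) +
          (y + 1) * ∑ k ∈ range (n + 1), (r k : ℂ) / (n + 1 - k) / (x + k) := by
        rw [mul_sum, ← sum_add_distrib]
        refine sum_congr rfl fun k hk => ?_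
        rw [if_neg (by have := mem_range.mp hk; lia)]
        push_cast
        ring
      rw [h2]
      simp only [if_true]
      push_cast
      ring

theorem tendsto_gammaRatioApprox (y : ℝ) (x : ℂ) :
    Tendsto (fun n : ℕ => (n : ℂ) ^ (-(y : ℂ)) * (n : ℂ)⁻¹ * gammaRatioApprox y n x) atTop
      (𝓝 (Complex.Gamma x / Complex.Gamma (x + y))) := by
  have hn : Tendsto (fun n : ℕ => (x + y + 1) / (n : ℂ) + 1) atTop (𝓝 1) := by
    simpa using (tendsto_const_div_atTop_nhds_zero_nat (x + y + 1)).add_const 1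
  have hinv : Tendsto (fun n => (Complex.GammaSeq (x + y) n)⁻¹) atTop
      (𝓝 (Complex.Gamma (x + y))⁻¹) := by
    by_cases h0 : Complex.Gamma (x + y) = 0
    · obtain ⟨m, hm⟩ := (Complex.Gamma_eq_zero_iff _).1 h0
      rw [h0, inv_zero]
      refine tendsto_const_nhds.congr' ?_
      filter_upwards [eventually_ge_atTop m] with n hn
      rw [Complex.GammaSeq, prod_eq_zero (i := m) (by simp; lia) (by rw [hm]; ring)]
      simp
    · exact (Complex.GammaSeq_tendsto_Gamma _).inv₀ h0
  have h := ((Complex.GammaSeq_tendsto_Gamma x).mul hinv).mul hn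
  rw [mul_one, ← div_eq_mul_inv] at h
  refine h.congr' ?_
  filter_upwards [eventually_ge_atTop 1] with n hn1
  have hn0 : (n : ℂ) ≠ 0 := by exact_mod_cast (by lia : n ≠ 0)
  have hf : ((n.factorial : ℕ) : ℂ) ≠ 0 := by exact_mod_cast n.factorial_ne_zero
  have hp : (n : ℂ) ^ x ≠ 0 := by simp [Complex.cpow_eq_zero_iff, hn0]
  have hpy : (n : ℂ) ^ (y : ℂ) ≠ 0 := by simp [Complex.cpow_eq_zero_iff, hn0]
  rw [Complex.GammaSeq, Complex.GammaSeq, gammaRatioApprox, prod_div_distrib,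
    Complex.cpow_add _ _ hn0, Complex.cpow_neg]
  have e : (x + y + 1) / (n : ℂ) + 1 = (x + y + n + 1) * (n : ℂ)⁻¹ := by
    field_simp
    ring
  rw [e, inv_div]
  generalize ∏ j ∈ range (n + 1), (x + j) = A
  generalize ∏ j ∈ range (n + 1), (x + y + j) = B
  field_simp

theorem Real.Gamma_mul_self_add_one_pos {y : ℝ} (hy : -2 < y) (h0 : y ≠ 0) (h1 : y ≠ -1) :
    0 < Real.Gamma y * (y * (y + 1)) := by
  have h : Real.Gamma (y + 1 + 1) = (y + 1) * (y * Real.Gamma y) := by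
    rw [Real.Gamma_add_one (by intro h; apply h1; linarith), Real.Gamma_add_one h0]
  have := Real.Gamma_pos_of_pos (show 0 < y + 1 + 1 by linarith)
  linarith

theorem im_mul_im_cBeta_slope_nonneg {y α : ℝ} (hy : -2 < y) (hy' : y < 1) (h0 : y ≠ 0)
    (h1 : y ≠ -1) (hα : 0 < α) {u : ℂ} (hu : u.im ≠ 0) :
    0 ≤ u.im * ((cBeta (α + u) y - cBeta α y) / u).im := by
  set A : ℕ → ℂ → ℂ := fun n x => Complex.Gamma y * ((n : ℂ) ^ (-(y : ℂ)) * (n : ℂ)⁻¹) *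
    gammaRatioApprox y n x with hA
  have hlim : ∀ x : ℂ, Tendsto (fun n => A n x) atTop (𝓝 (cBeta x y)) := fun x => by
    have := (tendsto_gammaRatioApprox y x).const_mul (Complex.Gamma y)
    simpa only [hA, cBeta, mul_assoc, mul_comm (Complex.Gamma x), mul_div_assoc] using this
  have hl : Tendsto (fun n => u.im * ((A n (α + u) - A n α) / u).im) atTop
      (𝓝 (u.im * ((cBeta (α + u) y - cBeta α y) / u).im)) :=
    ((Complex.continuous_im.tendsto _).comp
      (((hlim _).sub (hlim _)).div_const u)).const_mul _
  refine ge_of_tendsto' hl fun n => ?_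
  obtain ⟨c, r, hr, h⟩ := exists_gammaRatioApprox_eq_sum hy hy' n
  have hαk : ∀ k : ℕ, (α : ℂ) + k ≠ 0 := fun k => by
    have : α + k ≠ 0 := by positivity
    exact_mod_cast this
  have hαu : ∀ k : ℕ, (α : ℂ) + u + k ≠ 0 := fun k hk => hu (by
    have := congrArg Complex.im hk
    simpa using this)
  have hu0 : u ≠ 0 := by rintro rfl; simp at hu
  set t : ℝ := Real.Gamma y * ((n : ℝ) ^ (-y) * (n : ℝ)⁻¹) with ht
  have htc : Complex.Gamma y * ((n : ℂ) ^ (-(y : ℂ)) * (n : ℂ)⁻¹) = t := by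
    rw [ht, Complex.Gamma_ofReal]
    push_cast
    rw [Complex.ofReal_cpow (by positivity)]
    push_cast
    rfl
  have htr : ∀ k ≤ n, 0 ≤ t * r k := fun k hk => by
    have hG := Real.Gamma_mul_self_add_one_pos hy h0 h1
    have hs : 0 ≤ Real.Gamma y * r k := by
      have h2 := mul_nonneg hG.le (hr k hk)
      have h3 : 0 < (y * (y + 1)) ^ 2 := by
        have : y * (y + 1) ≠ 0 := mul_ne_zero h0 (by intro h; apply h1; linarith)
        positivity
      nlinarith [h2]
    have : 0 ≤ (n : ℝ) ^ (-y) * (n : ℝ)⁻¹ := by positivity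
    calc 0 ≤ Real.Gamma y * r k * ((n : ℝ) ^ (-y) * (n : ℝ)⁻¹) := mul_nonneg hs this
      _ = t * r k := by rw [ht]; ring
  have hslope : (A n (α + u) - A n α) / u =
      t - ∑ k ∈ range (n + 1), ((t * r k / (α + k) : ℝ) : ℂ) * (α + u + k)⁻¹ := by
    simp only [hA]
    rw [htc, h _ fun k _ => hαu k, h _ fun k _ => hαk k,
      div_eq_iff hu0, sub_mul, sum_mul]
    have : ∀ k ∈ range (n + 1), ((t * r k / (α + k) : ℝ) : ℂ) * (α + u + k)⁻¹ * u =
        t * ((r k : ℂ) / (α + k)) - t * ((r k : ℂ) / (α + u + k)) := fun k _ => by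
      have := hαk k
      have := hαu k
      push_cast
      field_simp
      ring
    rw [sum_congr rfl this, sum_sub_distrib, ← mul_sum, ← mul_sum]
    ring
  rw [hslope, Complex.sub_im, Complex.ofReal_im, zero_sub, Complex.im_sum, ← sum_neg_distrib,
    mul_sum]
  refine sum_nonneg fun k hk => ?_
  have hc : 0 ≤ t * r k / (α + k) :=
    div_nonneg (htr k (Nat.lt_succ_iff.mp (mem_range.mp hk))) (by positivity)
  rw [Complex.im_ofReal_mul, Complex.inv_im]
  have him : ((α : ℂ) + u + k).im = u.im := by simp
  rw [him]
  have : 0 ≤ u.im * u.im / Complex.normSq (α + u + k) :=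
    div_nonneg (mul_self_nonneg _) (Complex.normSq_nonneg _)
  calc 0 ≤ (t * r k / (α + k)) * (u.im * u.im / Complex.normSq (α + u + k)) := mul_nonneg hc this
    _ = _ := by ring

theorem exists_tendsto_add_mul_cBeta {y : ℝ} (hy' : y < 1) (hy : Complex.Gamma y ≠ 0) (n : ℕ) :
    ∃ ρ : ℝ, 0 < ρ ∧
      Tendsto (fun x : ℂ => (x + n) * cBeta x y) (𝓝[≠] (-n : ℂ)) (𝓝 (ρ : ℂ)) := by
  induction n with
  | zero =>
    refine ⟨1, one_pos, ?_⟩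
    have hc : Tendsto (fun x : ℂ => (Complex.Gamma (x + y))⁻¹) (𝓝[≠] 0)
        (𝓝 (Complex.Gamma y)⁻¹) := by
      have : ContinuousAt (fun x : ℂ => (Complex.Gamma (x + y))⁻¹) 0 :=
        (Complex.differentiable_one_div_Gamma.continuous.comp
          (continuous_id.add continuous_const)).continuousAt
      simpa [ContinuousAt] using this.tendsto.mono_left nhdsWithin_le_nhds
    have h := (Complex.tendsto_self_mul_Gamma_nhds_zero.mul_const (Complex.Gamma y)).mul hc
    rw [one_mul, mul_inv_cancel₀ hy] at h
    simp only [Nat.cast_zero, add_zero, neg_zero, Complex.ofReal_one]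
    refine h.congr fun x => ?_
    rw [cBeta]
    ring
  | succ n ih =>
    obtain ⟨ρ, hρ, h⟩ := ih
    have hn : (0 : ℝ) < n + 1 := by positivity
    refine ⟨ρ * ((n + 1 - y) / (n + 1)), mul_pos hρ (div_pos (by
      have : (0 : ℝ) ≤ n := by positivity
      linarith) hn), ?_⟩
    have hnc : (n : ℂ) + 1 ≠ 0 := by exact_mod_cast hn.ne'
    have hshift : Tendsto (fun x : ℂ => x + 1) (𝓝[≠] (-((n + 1 : ℕ) : ℂ))) (𝓝[≠] (-n : ℂ)) := by
      refine tendsto_nhdsWithin_iff.2 ⟨?_, ?_⟩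
      · have : Tendsto (fun x : ℂ => x + 1) (𝓝 (-((n + 1 : ℕ) : ℂ)))
            (𝓝 (-((n + 1 : ℕ) : ℂ) + 1)) := (continuous_id.add continuous_const).tendsto _
        rw [show (-((n + 1 : ℕ) : ℂ) + 1) = -n by push_cast; ring] at this
        exact this.mono_left nhdsWithin_le_nhds
      · filter_upwards [self_mem_nhdsWithin] with x hx
        intro h
        apply hx
        push_cast
        rw [mem_singleton_iff] at h ⊢
        linear_combination h
    have hq : Tendsto (fun x : ℂ => (x + y) / x) (𝓝[≠] (-((n + 1 : ℕ) : ℂ)))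
        (𝓝 (((n + 1 - y) / (n + 1) : ℝ) : ℂ)) := by
      have : ContinuousAt (fun x : ℂ => (x + y) / x) (-((n + 1 : ℕ) : ℂ)) :=
        (continuousAt_id.add continuousAt_const).div continuousAt_id (by
          simpa using neg_ne_zero.2 hnc)
      have h2 := this.tendsto.mono_left (nhdsWithin_le_nhds (s := {(-((n + 1 : ℕ) : ℂ))}ᶜ))
      convert h2 using 2
      push_cast
      rw [← neg_div_neg_eq]
      congr 1
      ring
    have h3 := (h.comp hshift).mul hq
    rw [← Complex.ofReal_mul] at h3
    refine h3.congr' ?_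
    have h0 : ∀ᶠ x : ℂ in 𝓝[≠] (-((n + 1 : ℕ) : ℂ)), x ≠ 0 :=
      nhdsWithin_le_nhds (isOpen_ne.mem_nhds (by
        simpa using neg_ne_zero.2 hnc))
    filter_upwards [h0] with x hx
    simp only [Function.comp_apply, cBeta]
    rw [Complex.Gamma_add_one x hx, div_eq_mul_inv _ (Complex.Gamma (x + y)),
      Complex.one_div_Gamma_eq_self_mul_one_div_Gamma_add_one (x + y),
      show x + 1 + (y : ℂ) = x + y + 1 by ring]
    push_cast
    field_simp
    ring

theorem differentiableAt_cBeta {x : ℂ} (y : ℂ) (hx : ∀ n : ℕ, x ≠ -n) :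
    DifferentiableAt ℂ (fun x => cBeta x y) x := by
  unfold cBeta
  simp only [div_eq_mul_inv]
  exact ((Complex.differentiableAt_Gamma x hx).mul_const _).mul
    (Complex.differentiable_one_div_Gamma.comp (differentiable_id.add_const y) x)

theorem cBeta_ofReal_im (x y : ℝ) : (cBeta x y).im = 0 := by
  rw [cBeta, ← Complex.ofReal_add, Complex.Gamma_ofReal, Complex.Gamma_ofReal,
    Complex.Gamma_ofReal, ← Complex.ofReal_mul, ← Complex.ofReal_div, Complex.ofReal_im]

/-- A function which is real at a real point and maps the upper half-plane into the closed lower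
half-plane has nonpositive derivative at that point. -/
theorem re_deriv_nonpos_of_im_nonpos {f : ℂ → ℂ} {f' : ℂ} {x : ℝ} (hf : HasDerivAt f f' x)
    (h0 : (f x).im = 0) (h : ∀ w : ℂ, 0 < w.im → (f w).im ≤ 0) : f'.re ≤ 0 := by
  have hline : HasDerivAt (fun t : ℝ => (x : ℂ) + t * Complex.I) Complex.I 0 := by
    simpa using ((Complex.ofRealCLM.hasDerivAt (x := (0 : ℝ))).mul_const Complex.I).const_add
      (x : ℂ)
  have hcomp : HasDerivAt (fun t : ℝ => f (x + t * Complex.I)) (f' * Complex.I) 0 := by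
    have hf2 : HasDerivAt f f' ((x : ℂ) + ((0 : ℝ) : ℂ) * Complex.I) := by simpa using hf
    exact hf2.comp (0 : ℝ) hline
  have him : HasDerivAt (fun t : ℝ => (f (x + t * Complex.I)).im) f'.re 0 := by
    have := (Complex.imCLM.hasFDerivAt (x := f ((x : ℂ) + ((0 : ℝ) : ℂ) * Complex.I))).comp_hasDerivAt
      (0 : ℝ) hcomp
    simpa [Function.comp_def] using this
  have hs := him.hasDerivWithinAt (s := Ioi 0)
  rw [hasDerivWithinAt_iff_tendsto_slope' (by simp)] at hs
  refine le_of_tendsto hs ?_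
  filter_upwards [self_mem_nhdsWithin] with t ht
  rw [Set.mem_Ioi] at ht
  rw [slope_def_field]
  have h1 := h (x + t * Complex.I) (by simpa using ht)
  have h2 : (f (x + ((0 : ℝ) : ℂ) * Complex.I)).im = 0 := by simpa using h0
  rw [h2, sub_zero, sub_zero]
  exact div_nonpos_of_nonpos_of_nonneg h1 ht.le

section Exponent

variable {a σ c₁ c₂ α₁ α₂ β₁ β₂ lam₁ lam₂ : ℝ}

theorem betaClassExponent_neg (z : ℂ) :
    betaClassExponent (-a) σ c₂ c₁ α₂ α₁ β₂ β₁ lam₂ lam₁ (-z) =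
      betaClassExponent a σ c₁ c₂ α₁ α₂ β₁ β₂ lam₁ lam₂ z := by
  simp only [betaClassExponent, Complex.ofReal_neg, mul_neg, neg_div, sub_neg_eq_add,
    ← sub_eq_add_neg]
  ring

theorem neg_mem_betaClassPoles {z : ℂ} :
    -z ∈ betaClassPoles α₂ α₁ β₂ β₁ ↔ z ∈ betaClassPoles α₁ α₂ β₁ β₂ := by
  simp only [betaClassPoles, mem_union, mem_ofPred_eq, neg_mul, neg_inj]
  rw [or_comm]
  simp only [neg_eq_iff_eq_neg]

theorem betaClassExponent_I_mul (w : ℂ) :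
    betaClassExponent a σ c₁ c₂ α₁ α₂ β₁ β₂ lam₁ lam₂ (Complex.I * w) =
      -(a * w) - (σ : ℂ) ^ 2 * w ^ 2 / 2
        + (c₁ / β₁ : ℂ) * (cBeta α₁ (1 - lam₁ : ℝ) - cBeta (α₁ + w / β₁) (1 - lam₁ : ℝ))
        + (c₂ / β₂ : ℂ) * (cBeta α₂ (1 - lam₂ : ℝ) - cBeta (α₂ - w / β₂) (1 - lam₂ : ℝ)) := by
  have h1 : (α₁ : ℂ) - Complex.I * (Complex.I * w) / β₁ = α₁ + w / β₁ := by
    rw [← mul_assoc, Complex.I_mul_I]; ring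
  have h2 : (α₂ : ℂ) + Complex.I * (Complex.I * w) / β₂ = α₂ - w / β₂ := by
    rw [← mul_assoc, Complex.I_mul_I]; ring
  rw [betaClassExponent, h1, h2, mul_pow, Complex.I_sq]
  push_cast
  linear_combination (a * w : ℂ) * Complex.I_mul_I

theorem betaClassExponent_zero :
    betaClassExponent a σ c₁ c₂ α₁ α₂ β₁ β₂ lam₁ lam₂ 0 = 0 := by
  simp [betaClassExponent]

theorem betaClassExponent_I_mul_ofReal_im (x : ℝ) :
    (betaClassExponent a σ c₁ c₂ α₁ α₂ β₁ β₂ lam₁ lam₂ (Complex.I * x)).im = 0 := by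
  have h : ∀ s t : ℝ, cBeta s t = ((cBeta s t).re : ℂ) := fun s t =>
    Complex.ext (by simp) (by simp [cBeta_ofReal_im])
  have h1 : (α₁ : ℂ) + x / β₁ = (α₁ + x / β₁ : ℝ) := by push_cast; rfl
  have h2 : (α₂ : ℂ) - x / β₂ = (α₂ - x / β₂ : ℝ) := by push_cast; rfl
  rw [betaClassExponent_I_mul, h1, h2, h α₁, h α₂, h (α₁ + _), h (α₂ - _)]
  norm_cast

theorem differentiableAt_betaClassExponent (hβ₁ : 0 < β₁) (hβ₂ : 0 < β₂) {z : ℂ}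
    (hz : z ∉ betaClassPoles α₁ α₂ β₁ β₂) :
    DifferentiableAt ℂ (betaClassExponent a σ c₁ c₂ α₁ α₂ β₁ β₂ lam₁ lam₂) z := by
  have hb₁ : (β₁ : ℂ) ≠ 0 := by exact_mod_cast hβ₁.ne'
  have hb₂ : (β₂ : ℂ) ≠ 0 := by exact_mod_cast hβ₂.ne'
  simp only [betaClassPoles, mem_union, mem_ofPred_eq, not_or, not_exists] at hz
  have h1 : DifferentiableAt ℂ
      (fun z : ℂ => cBeta ((α₁ : ℂ) - Complex.I * z / β₁) (1 - lam₁)) z := by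
    refine DifferentiableAt.comp z (differentiableAt_cBeta (1 - lam₁ : ℂ) fun n hn => hz.1 n ?_)
      (f := fun z : ℂ => (α₁ : ℂ) - Complex.I * z / β₁) (by fun_prop)
    field_simp at hn
    linear_combination Complex.I * hn + z * Complex.I_mul_I
  have h2 : DifferentiableAt ℂ
      (fun z : ℂ => cBeta ((α₂ : ℂ) + Complex.I * z / β₂) (1 - lam₂)) z := by
    refine DifferentiableAt.comp z (differentiableAt_cBeta (1 - lam₂ : ℂ) fun n hn => hz.2 n ?_)
      (f := fun z : ℂ => (α₂ : ℂ) + Complex.I * z / β₂) (by fun_prop)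
    field_simp at hn
    linear_combination (-Complex.I) * hn + z * Complex.I_mul_I
  unfold betaClassExponent
  fun_prop

theorem I_mul_notMem_betaClassPoles (hα₁ : 0 < α₁) (hβ₁ : 0 < β₁) {x : ℝ} (hx : 0 ≤ x)
    (h : ∀ n : ℕ, x ≠ β₂ * (α₂ + n)) : Complex.I * x ∉ betaClassPoles α₁ α₂ β₁ β₂ := by
  rintro (⟨n, hn⟩ | ⟨n, hn⟩)
  · have h1 : (x : ℂ) = ((-(β₁ * (α₁ + n)) : ℝ) : ℂ) := by
      apply mul_left_cancel₀ Complex.I_ne_zero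
      rw [hn]; push_cast; ring
    have h2 : x = -(β₁ * (α₁ + n)) := by exact_mod_cast h1
    have : 0 < β₁ * (α₁ + n) := by positivity
    linarith
  · have h1 : (x : ℂ) = ((β₂ * (α₂ + n) : ℝ) : ℂ) := by
      apply mul_left_cancel₀ Complex.I_ne_zero
      rw [hn]; push_cast; ring
    exact h n (by exact_mod_cast h1)

theorem Gamma_one_sub_ne_zero {lam : ℝ} (h : lam ∈ Set.Ioo (0 : ℝ) 3 ∧ lam ≠ 1 ∧ lam ≠ 2) :
    Complex.Gamma (1 - lam : ℝ) ≠ 0 := by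
  obtain ⟨⟨h0, h3⟩, h1, h2⟩ := h
  have := Real.Gamma_mul_self_add_one_pos (y := 1 - lam) (by linarith)
    (by intro h; apply h1; linarith) (by intro h; apply h2; linarith)
  rw [Complex.Gamma_ofReal]
  exact_mod_cast left_ne_zero_of_mul this.ne'

theorem im_betaClassExponent_I_mul_div_nonpos (hc₁ : 0 < c₁) (hc₂ : 0 < c₂) (hα₁ : 0 < α₁)
    (hα₂ : 0 < α₂) (hβ₁ : 0 < β₁) (hβ₂ : 0 < β₂)
    (hlam₁ : lam₁ ∈ Set.Ioo (0 : ℝ) 3 ∧ lam₁ ≠ 1 ∧ lam₁ ≠ 2)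
    (hlam₂ : lam₂ ∈ Set.Ioo (0 : ℝ) 3 ∧ lam₂ ≠ 1 ∧ lam₂ ≠ 2) {w : ℂ} (hw : 0 < w.im) :
    (betaClassExponent a σ c₁ c₂ α₁ α₂ β₁ β₂ lam₁ lam₂ (Complex.I * w) / w).im ≤ 0 := by
  have hw0 : w ≠ 0 := by rintro rfl; simp at hw
  have hb₁ : (β₁ : ℂ) ≠ 0 := by exact_mod_cast hβ₁.ne'
  have hb₂ : (β₂ : ℂ) ≠ 0 := by exact_mod_cast hβ₂.ne'
  have slope_sign : ∀ {lam α : ℝ}, lam ∈ Set.Ioo (0 : ℝ) 3 ∧ lam ≠ 1 ∧ lam ≠ 2 → 0 < α →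
      ∀ {u : ℂ}, u.im ≠ 0 →
        0 ≤ u.im * ((cBeta (α + u) (1 - lam : ℝ) - cBeta α (1 - lam : ℝ)) / u).im := by
    rintro lam α ⟨⟨h0, h3⟩, h1, h2⟩ hα u hu
    exact im_mul_im_cBeta_slope_nonneg (by linarith) (by linarith)
      (by intro h; apply h1; linarith) (by intro h; apply h2; linarith) hα hu
  have i₁ : (w / β₁).im = w.im / β₁ := by simp
  have i₂ : (-w / β₂).im = -(w.im / β₂) := by simp [neg_div]
  have p₁ : 0 < w.im / β₁ := by positivity
  have p₂ : 0 < w.im / β₂ := by positivity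
  have s₁ := slope_sign hlam₁ hα₁ (u := w / β₁) (by rw [i₁]; exact p₁.ne')
  have s₂ := slope_sign hlam₂ hα₂ (u := -w / β₂) (by rw [i₂]; exact (neg_neg_of_pos p₂).ne)
  rw [i₁] at s₁
  rw [i₂] at s₂
  have t₁ := nonneg_of_mul_nonneg_right s₁ p₁
  have t₂ : ((cBeta (α₂ + -w / β₂) (1 - lam₂ : ℝ) - cBeta α₂ (1 - lam₂ : ℝ)) / (-w / β₂)).im
      ≤ 0 := by
    by_contra! hcon
    nlinarith [mul_pos p₂ hcon]
  have key : betaClassExponent a σ c₁ c₂ α₁ α₂ β₁ β₂ lam₁ lam₂ (Complex.I * w) / w =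
      ((-a : ℝ) : ℂ) - ((σ ^ 2 / 2 : ℝ) : ℂ) * w
      - ((c₁ / β₁ ^ 2 : ℝ) : ℂ) *
          ((cBeta (α₁ + w / β₁) (1 - lam₁ : ℝ) - cBeta α₁ (1 - lam₁ : ℝ)) / (w / β₁))
      + ((c₂ / β₂ ^ 2 : ℝ) : ℂ) *
          ((cBeta (α₂ + -w / β₂) (1 - lam₂ : ℝ) - cBeta α₂ (1 - lam₂ : ℝ)) / (-w / β₂)) := by
    rw [betaClassExponent_I_mul, show (α₂ : ℂ) - w / β₂ = α₂ + -w / β₂ by ring]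
    generalize cBeta (α₁ + w / β₁) (1 - lam₁ : ℝ) = X
    generalize cBeta (α₂ + -w / β₂) (1 - lam₂ : ℝ) = Y
    push_cast
    field_simp
    ring
  rw [key, Complex.add_im, Complex.sub_im, Complex.sub_im, Complex.ofReal_im,
    Complex.im_ofReal_mul, Complex.im_ofReal_mul, Complex.im_ofReal_mul]
  have u₁ := mul_nonneg (show 0 ≤ c₁ / β₁ ^ 2 by positivity) t₁
  have u₂ := mul_nonpos_of_nonneg_of_nonpos (show 0 ≤ c₂ / β₂ ^ 2 by positivity) t₂
  have u₃ := mul_nonneg (show 0 ≤ σ ^ 2 / 2 by positivity) hw.le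
  linarith

theorem hasDerivAt_betaClassExponent_I_mul_div (hβ₁ : 0 < β₁) (hβ₂ : 0 < β₂) {w : ℂ} (hw : w ≠ 0)
    (hp : Complex.I * w ∉ betaClassPoles α₁ α₂ β₁ β₂) :
    HasDerivAt
      (fun v => betaClassExponent a σ c₁ c₂ α₁ α₂ β₁ β₂ lam₁ lam₂ (Complex.I * v) / v)
      ((deriv (betaClassExponent a σ c₁ c₂ α₁ α₂ β₁ β₂ lam₁ lam₂) (Complex.I * w) * Complex.I * w
        - betaClassExponent a σ c₁ c₂ α₁ α₂ β₁ β₂ lam₁ lam₂ (Complex.I * w)) / w ^ 2) w := by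
  have h1 := (differentiableAt_betaClassExponent (a := a) (σ := σ) (c₁ := c₁) (c₂ := c₂)
    (lam₁ := lam₁) (lam₂ := lam₂) hβ₁ hβ₂ hp).hasDerivAt
  have h2 : HasDerivAt (fun v : ℂ => Complex.I * v) Complex.I w := by
    simpa using (hasDerivAt_id w).const_mul Complex.I
  simpa [Function.comp_def] using (h1.comp w h2).fun_div (hasDerivAt_id' w) hw

theorem deriv_betaClassExponent_ne_zero (hc₁ : 0 < c₁) (hc₂ : 0 < c₂) (hα₁ : 0 < α₁)
    (hα₂ : 0 < α₂) (hβ₁ : 0 < β₁) (hβ₂ : 0 < β₂)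
    (hlam₁ : lam₁ ∈ Set.Ioo (0 : ℝ) 3 ∧ lam₁ ≠ 1 ∧ lam₁ ≠ 2)
    (hlam₂ : lam₂ ∈ Set.Ioo (0 : ℝ) 3 ∧ lam₂ ≠ 1 ∧ lam₂ ≠ 2) {q : ℝ} (hq : 0 < q) {x : ℝ}
    (hx : x ≠ 0) (hp : Complex.I * x ∉ betaClassPoles α₁ α₂ β₁ β₂)
    (h : q + betaClassExponent a σ c₁ c₂ α₁ α₂ β₁ β₂ lam₁ lam₂ (Complex.I * x) = 0) :
    deriv (betaClassExponent a σ c₁ c₂ α₁ α₂ β₁ β₂ lam₁ lam₂) (Complex.I * x) ≠ 0 := by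
  intro hd
  have h1 := hasDerivAt_betaClassExponent_I_mul_div (a := a) (σ := σ) (c₁ := c₁) (c₂ := c₂)
    (lam₁ := lam₁) (lam₂ := lam₂) hβ₁ hβ₂ (Complex.ofReal_ne_zero.2 hx) hp
  have h2 := re_deriv_nonpos_of_im_nonpos h1 (by
      rw [Complex.div_ofReal_im, betaClassExponent_I_mul_ofReal_im, zero_div])
    fun w hw => im_betaClassExponent_I_mul_div_nonpos hc₁ hc₂ hα₁ hα₂ hβ₁ hβ₂ hlam₁ hlam₂ hw
  rw [hd, show betaClassExponent a σ c₁ c₂ α₁ α₂ β₁ β₂ lam₁ lam₂ (Complex.I * x) = -q by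
    linear_combination h, zero_mul, zero_mul, zero_sub, neg_neg, ← Complex.ofReal_pow,
    ← Complex.ofReal_div, Complex.ofReal_re] at h2
  have : 0 < q / x ^ 2 := by positivity
  linarith

theorem not_lt_of_roots (hc₁ : 0 < c₁) (hc₂ : 0 < c₂) (hα₁ : 0 < α₁)
    (hα₂ : 0 < α₂) (hβ₁ : 0 < β₁) (hβ₂ : 0 < β₂)
    (hlam₁ : lam₁ ∈ Set.Ioo (0 : ℝ) 3 ∧ lam₁ ≠ 1 ∧ lam₁ ≠ 2)
    (hlam₂ : lam₂ ∈ Set.Ioo (0 : ℝ) 3 ∧ lam₂ ≠ 1 ∧ lam₂ ≠ 2) {q : ℝ} (hq : 0 < q) {s t : ℝ}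
    (hs : 0 < s) (hp : ∀ x ∈ Set.Icc s t, Complex.I * (x : ℝ) ∉ betaClassPoles α₁ α₂ β₁ β₂)
    (h : q + betaClassExponent a σ c₁ c₂ α₁ α₂ β₁ β₂ lam₁ lam₂ (Complex.I * s) = 0)
    (h' : q + betaClassExponent a σ c₁ c₂ α₁ α₂ β₁ β₂ lam₁ lam₂ (Complex.I * t) = 0) :
    ¬ s < t := by
  intro hst
  set k : ℝ → ℝ := fun x =>
    (betaClassExponent a σ c₁ c₂ α₁ α₂ β₁ β₂ lam₁ lam₂ (Complex.I * x) / x).re with hk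
  have hderiv : ∀ x ∈ Set.Icc s t, ∃ d ≤ 0, HasDerivAt k d x := fun x hx => by
    have h1 := hasDerivAt_betaClassExponent_I_mul_div (a := a) (σ := σ) (c₁ := c₁) (c₂ := c₂)
      (lam₁ := lam₁) (lam₂ := lam₂) hβ₁ hβ₂
      (Complex.ofReal_ne_zero.2 (hs.trans_le hx.1).ne') (hp x hx)
    exact ⟨_, re_deriv_nonpos_of_im_nonpos h1 (by
      rw [Complex.div_ofReal_im, betaClassExponent_I_mul_ofReal_im, zero_div])
      fun w hw => im_betaClassExponent_I_mul_div_nonpos hc₁ hc₂ hα₁ hα₂ hβ₁ hβ₂ hlam₁ hlam₂ hw,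
      h1.real_of_complex⟩
  have hanti : AntitoneOn k (Set.Icc s t) := by
    refine antitoneOn_of_deriv_nonpos (convex_Icc s t)
      (fun x hx => (hderiv x hx).choose_spec.2.continuousAt.continuousWithinAt)
      (fun x hx => ?_) fun x hx => ?_
    · exact (hderiv x (interior_subset hx)).choose_spec.2.differentiableAt.differentiableWithinAt
    · rw [(hderiv x (interior_subset hx)).choose_spec.2.deriv]
      exact (hderiv x (interior_subset hx)).choose_spec.1
  have hle := hanti (left_mem_Icc.2 hst.le) (right_mem_Icc.2 hst.le) hst.le
  have hval : ∀ x : ℝ,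
      q + betaClassExponent a σ c₁ c₂ α₁ α₂ β₁ β₂ lam₁ lam₂ (Complex.I * x) = 0 →
      k x = -(q / x) := fun x hx => by
    simp only [hk]
    rw [show betaClassExponent a σ c₁ c₂ α₁ α₂ β₁ β₂ lam₁ lam₂ (Complex.I * x) = -q by
      linear_combination hx, Complex.div_ofReal_re, Complex.neg_re, Complex.ofReal_re, neg_div]
  rw [hval s h, hval t h'] at hle
  have := div_lt_div_of_pos_left hq hs hst
  linarith

theorem exists_tendsto_betaClassExponent_residue (hc₂ : 0 < c₂) (hα₁ : 0 < α₁) (hα₂ : 0 < α₂)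
    (hβ₁ : 0 < β₁) (hβ₂ : 0 < β₂)
    (hlam₂ : lam₂ ∈ Set.Ioo (0 : ℝ) 3 ∧ lam₂ ≠ 1 ∧ lam₂ ≠ 2) (n : ℕ) :
    ∃ ρ < 0, Tendsto (fun x : ℝ => (β₂ * (α₂ + n) - x) *
      (betaClassExponent a σ c₁ c₂ α₁ α₂ β₁ β₂ lam₁ lam₂ (Complex.I * x)).re)
      (𝓝[≠] (β₂ * (α₂ + n))) (𝓝 ρ) := by
  obtain ⟨ρ, hρ, h⟩ := exists_tendsto_add_mul_cBeta (y := 1 - lam₂) (by linarith [hlam₂.1.1])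
    (Gamma_one_sub_ne_zero hlam₂) n
  have hb₂ : (β₂ : ℂ) ≠ 0 := by exact_mod_cast hβ₂.ne'
  set p : ℝ := β₂ * (α₂ + n) with hp
  have hp0 : 0 < p := by positivity
  set rest : ℂ → ℂ := fun w => -(a * w) - (σ : ℂ) ^ 2 * w ^ 2 / 2
    + (c₁ / β₁ : ℂ) * (cBeta α₁ (1 - lam₁ : ℝ) - cBeta (α₁ + w / β₁) (1 - lam₁ : ℝ))
    + (c₂ / β₂ : ℂ) * cBeta α₂ (1 - lam₂ : ℝ) with hrest
  have hrc : ContinuousAt rest p := by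
    have : ContinuousAt (fun w : ℂ => cBeta (α₁ + w / β₁) (1 - lam₁ : ℝ)) p := by
      refine ContinuousAt.comp (f := fun w : ℂ => (α₁ : ℂ) + w / β₁)
        (differentiableAt_cBeta ((1 - lam₁ : ℝ) : ℂ) fun m hm => ?_).continuousAt (by fun_prop)
      have h1 : α₁ + p / β₁ = -m := by exact_mod_cast hm
      have h2 : 0 < α₁ + p / β₁ := by positivity
      have h3 : (0 : ℝ) ≤ m := by positivity
      linarith
    simp only [hrest]
    fun_prop
  have hsub : Tendsto (fun x : ℝ => (α₂ : ℂ) - (x : ℂ) / β₂) (𝓝[≠] p) (𝓝[≠] (-n : ℂ)) := by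
    refine tendsto_nhdsWithin_iff.2 ⟨?_, ?_⟩
    · have hc : Continuous fun x : ℝ => (α₂ : ℂ) - (x : ℂ) / β₂ := by fun_prop
      have := (hc.tendsto p).mono_left (nhdsWithin_le_nhds (s := {p}ᶜ))
      convert this using 2
      rw [hp]
      push_cast
      field_simp
      ring
    · filter_upwards [self_mem_nhdsWithin] with x hx hx'
      apply hx
      have h1 : (α₂ : ℂ) - (x : ℂ) / β₂ = -n := hx'
      have h2 : α₂ - x / β₂ = -n := by exact_mod_cast h1
      field_simp at h2
      rw [Set.mem_singleton_iff, hp]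
      linarith
  have h0 : Tendsto (fun x : ℝ => ((p : ℂ) - x)) (𝓝[≠] p) (𝓝 0) := by
    have hc : Continuous fun x : ℝ => (p : ℂ) - x := by fun_prop
    simpa using (hc.tendsto p).mono_left (nhdsWithin_le_nhds (s := {p}ᶜ))
  have hr : Tendsto (fun x : ℝ => rest x) (𝓝[≠] p) (𝓝 (rest p)) :=
    (hrc.tendsto.comp (Complex.continuous_ofReal.tendsto p)).mono_left nhdsWithin_le_nhds
  have hlim := (h0.mul hr).sub ((h.comp hsub).const_mul (c₂ : ℂ))
  refine ⟨-(c₂ * ρ), by have := mul_pos hc₂ hρ; linarith, ?_⟩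
  have hre := (Complex.continuous_re.tendsto _).comp hlim
  rw [zero_mul, zero_sub, ← Complex.ofReal_mul, Complex.neg_re, Complex.ofReal_re] at hre
  refine hre.congr fun x => ?_
  rw [← Complex.re_ofReal_mul, betaClassExponent_I_mul]
  simp only [Function.comp_apply, hrest]
  congr 1
  rw [hp]
  push_cast
  field_simp
  ring

theorem tendsto_betaClassExponent_atBot (hc₂ : 0 < c₂) (hα₁ : 0 < α₁) (hα₂ : 0 < α₂)
    (hβ₁ : 0 < β₁) (hβ₂ : 0 < β₂)
    (hlam₂ : lam₂ ∈ Set.Ioo (0 : ℝ) 3 ∧ lam₂ ≠ 1 ∧ lam₂ ≠ 2) (n : ℕ) :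
    Tendsto (fun x : ℝ =>
      (betaClassExponent a σ c₁ c₂ α₁ α₂ β₁ β₂ lam₁ lam₂ (Complex.I * x)).re)
      (𝓝[<] (β₂ * (α₂ + n))) atBot := by
  obtain ⟨ρ, hρ, h⟩ := exists_tendsto_betaClassExponent_residue (a := a) (σ := σ) (c₁ := c₁)
    (lam₁ := lam₁) hc₂ hα₁ hα₂ hβ₁ hβ₂ hlam₂ n
  set p : ℝ := β₂ * (α₂ + n)
  have h0 : Tendsto (fun x : ℝ => (p - x)⁻¹) (𝓝[<] p) atTop := by
    refine tendsto_inv_nhdsGT_zero.comp (tendsto_nhdsWithin_iff.2 ⟨?_, ?_⟩)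
    · have hc : Continuous fun x : ℝ => p - x := by fun_prop
      simpa using (hc.tendsto p).mono_left (nhdsWithin_le_nhds (s := Set.Iio p))
    · filter_upwards [self_mem_nhdsWithin] with x hx
      exact sub_pos.2 (Set.mem_Iio.1 hx)
  refine (h0.atTop_mul_neg hρ (h.mono_left (nhdsLT_le_nhdsNE p))).congr' ?_
  filter_upwards [self_mem_nhdsWithin] with x hx
  exact inv_mul_cancel_left₀ (sub_pos.2 (Set.mem_Iio.1 hx)).ne' _

theorem tendsto_betaClassExponent_atTop (hc₂ : 0 < c₂) (hα₁ : 0 < α₁) (hα₂ : 0 < α₂)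
    (hβ₁ : 0 < β₁) (hβ₂ : 0 < β₂)
    (hlam₂ : lam₂ ∈ Set.Ioo (0 : ℝ) 3 ∧ lam₂ ≠ 1 ∧ lam₂ ≠ 2) (n : ℕ) :
    Tendsto (fun x : ℝ =>
      (betaClassExponent a σ c₁ c₂ α₁ α₂ β₁ β₂ lam₁ lam₂ (Complex.I * x)).re)
      (𝓝[>] (β₂ * (α₂ + n))) atTop := by
  obtain ⟨ρ, hρ, h⟩ := exists_tendsto_betaClassExponent_residue (a := a) (σ := σ) (c₁ := c₁)
    (lam₁ := lam₁) hc₂ hα₁ hα₂ hβ₁ hβ₂ hlam₂ n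
  set p : ℝ := β₂ * (α₂ + n)
  have h0 : Tendsto (fun x : ℝ => (p - x)⁻¹) (𝓝[>] p) atBot := by
    refine tendsto_inv_nhdsLT_zero.comp (tendsto_nhdsWithin_iff.2 ⟨?_, ?_⟩)
    · have hc : Continuous fun x : ℝ => p - x := by fun_prop
      simpa using (hc.tendsto p).mono_left (nhdsWithin_le_nhds (s := Set.Ioi p))
    · filter_upwards [self_mem_nhdsWithin] with x hx
      exact sub_neg.2 (Set.mem_Ioi.1 hx)
  refine (h0.atBot_mul_neg hρ (h.mono_left (nhdsGT_le_nhdsNE p))).congr' ?_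
  filter_upwards [self_mem_nhdsWithin] with x hx
  exact inv_mul_cancel_left₀ (sub_neg.2 (Set.mem_Ioi.1 hx)).ne _

theorem exists_positive_roots (hc₁ : 0 < c₁) (hc₂ : 0 < c₂) (hα₁ : 0 < α₁)
    (hα₂ : 0 < α₂) (hβ₁ : 0 < β₁) (hβ₂ : 0 < β₂)
    (hlam₁ : lam₁ ∈ Set.Ioo (0 : ℝ) 3 ∧ lam₁ ≠ 1 ∧ lam₁ ≠ 2)
    (hlam₂ : lam₂ ∈ Set.Ioo (0 : ℝ) 3 ∧ lam₂ ≠ 1 ∧ lam₂ ≠ 2) {q : ℝ} (hq : 0 < q) :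
    ∃ ζ : ℕ → ℝ, ζ 0 ∈ Set.Ioo 0 (β₂ * α₂) ∧
      (∀ n : ℕ, 1 ≤ n → ζ n ∈ Set.Ioo (β₂ * (α₂ + n - 1)) (β₂ * (α₂ + n))) ∧
      (∀ n, Complex.I * ζ n ∉ betaClassPoles α₁ α₂ β₁ β₂ ∧
        q + betaClassExponent a σ c₁ c₂ α₁ α₂ β₁ β₂ lam₁ lam₂ (Complex.I * ζ n) = 0) ∧
      ∀ x : ℝ, 0 < x → Complex.I * x ∉ betaClassPoles α₁ α₂ β₁ β₂ →
        q + betaClassExponent a σ c₁ c₂ α₁ α₂ β₁ β₂ lam₁ lam₂ (Complex.I * x) = 0 →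
        ∃ n, ζ n = x := by
  set f : ℝ → ℝ := fun x =>
    (betaClassExponent a σ c₁ c₂ α₁ α₂ β₁ β₂ lam₁ lam₂ (Complex.I * x)).re with hf
  have hcont : ∀ x : ℝ, Complex.I * x ∉ betaClassPoles α₁ α₂ β₁ β₂ → ContinuousAt f x :=
    fun x hx => by
      refine Complex.continuous_re.continuousAt.comp (ContinuousAt.comp
        (f := fun x : ℝ => Complex.I * (x : ℂ))
        (differentiableAt_betaClassExponent hβ₁ hβ₂ hx).continuousAt (by fun_prop))
  have hroot : ∀ x : ℝ, f x = -q →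
      q + betaClassExponent a σ c₁ c₂ α₁ α₂ β₁ β₂ lam₁ lam₂ (Complex.I * x) = 0 := fun x hx => by
    apply Complex.ext
    · rw [Complex.add_re, Complex.ofReal_re, Complex.zero_re]
      linarith
    · rw [Complex.add_im, betaClassExponent_I_mul_ofReal_im]
      simp
  set L : ℕ → ℝ := fun n => if n = 0 then 0 else β₂ * (α₂ + n - 1) with hL
  have hL0 : ∀ n, 0 ≤ L n := fun n => by
    simp only [hL]
    split_ifs with h
    · exact le_rfl
    · have : (1 : ℝ) ≤ n := by exact_mod_cast Nat.one_le_iff_ne_zero.2 h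
      exact mul_nonneg hβ₂.le (by linarith)
  have hnp : ∀ n, ∀ x ∈ Set.Ioo (L n) (β₂ * (α₂ + n)),
      Complex.I * x ∉ betaClassPoles α₁ α₂ β₁ β₂ := fun n x hx =>
    I_mul_notMem_betaClassPoles hα₁ hβ₁ ((hL0 n).trans hx.1.le) fun m hm => by
      rcases lt_or_ge m n with hmn | hmn
      · have h1 := hx.1
        rw [hm] at h1
        simp only [hL, if_neg (show n ≠ 0 by lia)] at h1
        have h2 : (m : ℝ) + 1 ≤ n := by exact_mod_cast hmn
        nlinarith
      · have h1 := hx.2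
        rw [hm] at h1
        have h2 : (n : ℝ) ≤ m := by exact_mod_cast hmn
        nlinarith
  have hex : ∀ n, ∃ x ∈ Set.Ioo (L n) (β₂ * (α₂ + n)), f x = -q := fun n => by
    have hbot := tendsto_betaClassExponent_atBot (a := a) (σ := σ) (c₁ := c₁) (lam₁ := lam₁)
      hc₂ hα₁ hα₂ hβ₁ hβ₂ hlam₂ n
    rcases n with _ | n
    · have hpos : 0 < β₂ * (α₂ + (0 : ℕ)) := by positivity
      have hf0 : f 0 = 0 := by simp [hf, betaClassExponent_zero]
      have hsub := isPreconnected_Ico.intermediate_value_Iic (f := f)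
        (s := Set.Ico 0 (β₂ * (α₂ + (0 : ℕ)))) (l := 𝓝[<] (β₂ * (α₂ + (0 : ℕ))))
        ⟨le_rfl, hpos⟩ (le_principal_iff.2 (Ico_mem_nhdsLT hpos))
        (fun x hx => (hcont x ?_).continuousWithinAt) hbot
      · obtain ⟨x, hx, hxq⟩ := hsub (show -q ∈ Set.Iic (f 0) by
          rw [hf0, Set.mem_Iic]; linarith)
        refine ⟨x, ⟨?_, hx.2⟩, hxq⟩
        simp only [hL, if_true]
        refine lt_of_le_of_ne hx.1 ?_
        rintro rfl
        rw [hf0] at hxq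
        linarith
      · refine I_mul_notMem_betaClassPoles hα₁ hβ₁ hx.1 fun m hm => ?_
        have h1 := hx.2
        rw [hm] at h1
        have h2 : ((0 : ℕ) : ℝ) ≤ m := by exact_mod_cast m.zero_le
        nlinarith
    · have htop := tendsto_betaClassExponent_atTop (a := a) (σ := σ) (c₁ := c₁) (lam₁ := lam₁)
        hc₂ hα₁ hα₂ hβ₁ hβ₂ hlam₂ n
      have hLn : L (n + 1) = β₂ * (α₂ + n) := by
        simp only [hL, if_neg (Nat.succ_ne_zero n)]
        push_cast
        ring
      have hlt : L (n + 1) < β₂ * (α₂ + (n + 1 : ℕ)) := by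
        rw [hLn]
        push_cast
        nlinarith
      rw [← hLn] at htop
      obtain ⟨x, hx, hxq⟩ := isPreconnected_Ioo.intermediate_value_Iii (f := f)
        (le_principal_iff.2 (Ioo_mem_nhdsLT hlt)) (le_principal_iff.2 (Ioo_mem_nhdsGT hlt))
        (fun x hx => (hcont x (hnp _ x hx)).continuousWithinAt) hbot htop (Set.mem_univ (-q))
      exact ⟨x, hx, hxq⟩
  choose ζ hζ hζq using hex
  refine ⟨ζ, by simpa [hL] using hζ 0, fun n hn => ?_,
    fun n => ⟨hnp n _ (hζ n), hroot _ (hζq n)⟩, fun x hx hxp hxq => ?_⟩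
  · simpa only [hL, if_neg (show n ≠ 0 by lia)] using hζ n
  · have hexn : ∃ n : ℕ, x < β₂ * (α₂ + n) := by
      obtain ⟨n, hn⟩ := exists_nat_gt (x / β₂)
      refine ⟨n, ?_⟩
      rw [div_lt_iff₀ hβ₂] at hn
      nlinarith
    classical
    obtain ⟨n, hn, hmin⟩ : ∃ n : ℕ, x < β₂ * (α₂ + n) ∧ ∀ m < n, ¬ x < β₂ * (α₂ + m) :=
      ⟨Nat.find hexn, Nat.find_spec hexn, fun m hm => Nat.find_min hexn hm⟩
    have hxn : x ∈ Set.Ioo (L n) (β₂ * (α₂ + n)) := by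
      refine ⟨?_, hn⟩
      simp only [hL]
      split_ifs with h0
      · exact hx
      · obtain ⟨m, rfl⟩ := Nat.exists_eq_succ_of_ne_zero h0
        have hle := not_lt.1 (hmin m (by lia))
        refine lt_of_le_of_ne (by push_cast; linarith) fun heq => hxp (Or.inr ⟨m, ?_⟩)
        rw [← heq]
        push_cast
        ring
    have hIcc : ∀ s ∈ Set.Ioo (L n) (β₂ * (α₂ + n)), ∀ t ∈ Set.Ioo (L n) (β₂ * (α₂ + n)),
        ∀ y ∈ Set.Icc s t, Complex.I * (y : ℝ) ∉ betaClassPoles α₁ α₂ β₁ β₂ :=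
      fun s hs t ht y hy => hnp n y ⟨hs.1.trans_le hy.1, hy.2.trans_lt ht.2⟩
    refine ⟨n, le_antisymm (not_lt.1 ?_) (not_lt.1 ?_)⟩
    · exact not_lt_of_roots hc₁ hc₂ hα₁ hα₂ hβ₁ hβ₂ hlam₁ hlam₂ hq hx
        (hIcc _ hxn _ (hζ n)) hxq (hroot _ (hζq n))
    · exact not_lt_of_roots hc₁ hc₂ hα₁ hα₂ hβ₁ hβ₂ hlam₁ hlam₂ hq ((hL0 n).trans_lt (hζ n).1)
        (hIcc _ (hζ n) _ hxn) (hroot _ (hζq n)) hxq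

theorem re_nonneg_of_root (hc₁ : 0 < c₁) (hc₂ : 0 < c₂) (hα₁ : 0 < α₁)
    (hα₂ : 0 < α₂) (hβ₁ : 0 < β₁) (hβ₂ : 0 < β₂)
    (hlam₁ : lam₁ ∈ Set.Ioo (0 : ℝ) 3 ∧ lam₁ ≠ 1 ∧ lam₁ ≠ 2)
    (hlam₂ : lam₂ ∈ Set.Ioo (0 : ℝ) 3 ∧ lam₂ ≠ 1 ∧ lam₂ ≠ 2) {q : ℝ} (hq : 0 < q) {z : ℂ}
    (h : q + betaClassExponent a σ c₁ c₂ α₁ α₂ β₁ β₂ lam₁ lam₂ z = 0) : 0 ≤ z.re := by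
  by_contra! hz
  have hw : 0 < (-Complex.I * z).im := by simpa using hz
  have h1 := im_betaClassExponent_I_mul_div_nonpos (a := a) (σ := σ) hc₁ hc₂ hα₁ hα₂ hβ₁ hβ₂ hlam₁
    hlam₂ hw
  rw [show Complex.I * (-Complex.I * z) = z by linear_combination -z * Complex.I_mul_I,
    show betaClassExponent a σ c₁ c₂ α₁ α₂ β₁ β₂ lam₁ lam₂ z = ((-q : ℝ) : ℂ) by
      push_cast; linear_combination h, div_eq_mul_inv, Complex.im_ofReal_mul,
    Complex.inv_im] at h1
  have hn : 0 < Complex.normSq (-Complex.I * z) :=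
    Complex.normSq_pos.2 fun h0 => by rw [h0] at hw; simp at hw
  have := mul_pos hq (div_pos hw hn)
  rw [neg_div] at h1
  linarith

theorem root_eq_I_mul (hc₁ : 0 < c₁) (hc₂ : 0 < c₂) (hα₁ : 0 < α₁)
    (hα₂ : 0 < α₂) (hβ₁ : 0 < β₁) (hβ₂ : 0 < β₂)
    (hlam₁ : lam₁ ∈ Set.Ioo (0 : ℝ) 3 ∧ lam₁ ≠ 1 ∧ lam₁ ≠ 2)
    (hlam₂ : lam₂ ∈ Set.Ioo (0 : ℝ) 3 ∧ lam₂ ≠ 1 ∧ lam₂ ≠ 2) {q : ℝ} (hq : 0 < q) {z : ℂ}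
    (h : q + betaClassExponent a σ c₁ c₂ α₁ α₂ β₁ β₂ lam₁ lam₂ z = 0) :
    ∃ x : ℝ, x ≠ 0 ∧ z = Complex.I * x := by
  have h1 := re_nonneg_of_root hc₁ hc₂ hα₁ hα₂ hβ₁ hβ₂ hlam₁ hlam₂ hq h
  have h2 := re_nonneg_of_root hc₂ hc₁ hα₂ hα₁ hβ₂ hβ₁ hlam₂ hlam₁ hq (z := -z) (a := -a)
    (σ := σ) (by rw [betaClassExponent_neg]; exact h)
  rw [Complex.neg_re] at h2
  refine ⟨z.im, fun h0 => ?_, Complex.ext (by simp; linarith) (by simp)⟩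
  have hz : z = 0 := Complex.ext (by simp; linarith) (by simpa using h0)
  rw [hz, betaClassExponent_zero, add_zero] at h
  exact hq.ne' (by exact_mod_cast h)

end Exponent

end RootsAux

/-- **Roots of `q + Ψ = 0` for the β-class (Theorem 2).**
For every `q > 0`, all solutions of `q + Ψ(z) = 0` (as a meromorphic function,
i.e. away from the poles of `Ψ`) are simple and lie on the imaginary axis;
they can be enumerated as `{iζₙ⁺ : n ≥ 0}` and `{iζₙ⁻ : n ≥ 0}` with
`ζ₀⁺ ∈ (0, β₂α₂)`, `ζ₀⁻ ∈ (−β₁α₁, 0)`, `ζₙ⁺ ∈ (β₂(α₂+n−1), β₂(α₂+n))` and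
`ζₙ⁻ ∈ (−β₁(α₁+n), −β₁(α₁+n−1))` for `n ≥ 1`. -/
theorem betaClass_roots
    (a σ c₁ c₂ α₁ α₂ β₁ β₂ lam₁ lam₂ : ℝ)
    (hc₁ : 0 < c₁) (hc₂ : 0 < c₂) (hα₁ : 0 < α₁) (hα₂ : 0 < α₂)
    (hβ₁ : 0 < β₁) (hβ₂ : 0 < β₂)
    (hlam₁ : lam₁ ∈ Ioo (0 : ℝ) 3 ∧ lam₁ ≠ 1 ∧ lam₁ ≠ 2)
    (hlam₂ : lam₂ ∈ Ioo (0 : ℝ) 3 ∧ lam₂ ≠ 1 ∧ lam₂ ≠ 2)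
    (q : ℝ) (hq : 0 < q) :
    ∃ ζp ζm : ℕ → ℝ,
      ζp 0 ∈ Ioo 0 (β₂ * α₂) ∧
      ζm 0 ∈ Ioo (-(β₁ * α₁)) 0 ∧
      (∀ n : ℕ, 1 ≤ n → ζp n ∈ Ioo (β₂ * (α₂ + n - 1)) (β₂ * (α₂ + n))) ∧
      (∀ n : ℕ, 1 ≤ n → ζm n ∈ Ioo (-(β₁ * (α₁ + n))) (-(β₁ * (α₁ + n - 1)))) ∧
      {z : ℂ | z ∉ betaClassPoles α₁ α₂ β₁ β₂ ∧
          (q : ℂ) + betaClassExponent a σ c₁ c₂ α₁ α₂ β₁ β₂ lam₁ lam₂ z = 0}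
        = (range fun n : ℕ => Complex.I * (ζp n : ℂ))
            ∪ (range fun n : ℕ => Complex.I * (ζm n : ℂ)) ∧
      ∀ z : ℂ, z ∉ betaClassPoles α₁ α₂ β₁ β₂ →
        (q : ℂ) + betaClassExponent a σ c₁ c₂ α₁ α₂ β₁ β₂ lam₁ lam₂ z = 0 →
        deriv (fun w : ℂ =>
          (q : ℂ) + betaClassExponent a σ c₁ c₂ α₁ α₂ β₁ β₂ lam₁ lam₂ w) z ≠ 0 := by
  obtain ⟨ζp, hp0, hpn, hproot, hpall⟩ := exists_positive_roots (a := a) (σ := σ)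
    hc₁ hc₂ hα₁ hα₂ hβ₁ hβ₂ hlam₁ hlam₂ hq
  obtain ⟨ζm, hm0, hmn, hmroot, hmall⟩ := exists_positive_roots (a := -a) (σ := σ)
    hc₂ hc₁ hα₂ hα₁ hβ₂ hβ₁ hlam₂ hlam₁ hq
  have hneg : ∀ x : ℝ, Complex.I * x = -(Complex.I * ((-x : ℝ) : ℂ)) := fun x => by
    push_cast; ring
  refine ⟨ζp, fun n => -ζm n, hp0, ⟨neg_lt_neg hm0.2, neg_neg_of_pos hm0.1⟩, hpn,
    fun n hn => ⟨neg_lt_neg (hmn n hn).2, neg_lt_neg (hmn n hn).1⟩, ?_, fun z hz h => ?_⟩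
  · ext z
    constructor
    · rintro ⟨hz, h⟩
      obtain ⟨x, hx, rfl⟩ := root_eq_I_mul hc₁ hc₂ hα₁ hα₂ hβ₁ hβ₂ hlam₁ hlam₂ hq h
      rcases lt_or_gt_of_ne hx with hx | hx
      · rw [hneg x, ← neg_mem_betaClassPoles, neg_neg] at hz
        rw [hneg x, ← betaClassExponent_neg, neg_neg] at h
        obtain ⟨n, hn⟩ := hmall (-x) (neg_pos.2 hx) hz h
        exact Or.inr ⟨n, by simp [hn]⟩
      · obtain ⟨n, rfl⟩ := hpall x hx hz h
        exact Or.inl ⟨n, rfl⟩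
    · rintro (⟨n, rfl⟩ | ⟨n, rfl⟩)
      · exact hproot n
      · obtain ⟨h1, h2⟩ := hmroot n
        refine ⟨?_, ?_⟩ <;> beta_reduce
        · rwa [hneg, ← neg_mem_betaClassPoles, neg_neg, neg_neg]
        · rwa [hneg, ← betaClassExponent_neg, neg_neg, neg_neg]
  · obtain ⟨x, hx, rfl⟩ := root_eq_I_mul hc₁ hc₂ hα₁ hα₂ hβ₁ hβ₂ hlam₁ hlam₂ hq h
    rw [deriv_const_add']
    exact deriv_betaClassExponent_ne_zero hc₁ hc₂ hα₁ hα₂ hβ₁ hβ₂ hlam₁ hlam₂ hq hx hz h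

end
end
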